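/- arXiv:2503.08490 — 5 statements merged into one kernel-verified Lean document; each statement's English description precedes it below -/
import Mathlib

section
/- For every integer n ≥ 1, every integer j with 0 ≤ j ≤ n, and every z ∈ ℂ, the squared norm of the j-th Veronese section satisfies ‖V̂ⱼⁿ(z)‖² = (n!·j!/(n−j)!)·(1+|z|²)^{n−2j}. -/
open Complex Finset

/-- The `j`-th Veronese section `V̂ⱼⁿ : ℂ → ℂ^{n+1}`, whose `r`-th component is
`f_{j,r}(z) = (j!/(1+|z|²)^j)·√(binom n r)·Σ_{k=0}^{j} (−1)^k·binom r (j−k)·binom (n−r) k·z^{r−j+k}·conj(z)^k`. -/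
noncomputable def veroneseSection (n j : ℕ) (z : ℂ) : Fin (n + 1) → ℂ :=
  fun r =>
    ((j.factorial : ℂ) / (1 + (Complex.normSq z : ℂ)) ^ j) *
      (Real.sqrt (n.choose (r : ℕ)) : ℂ) *
      ∑ k ∈ Finset.range (j + 1),
        (-1 : ℂ) ^ k * ((r : ℕ).choose (j - k) : ℂ) * ((n - (r : ℕ)).choose k : ℂ) *
          z ^ ((r : ℕ) - (j - k)) * ((starRingEnd ℂ) z) ^ k

open Polynomial in
/-- The generating polynomial `(z + X)^r (1 - w X)^(n - r)`, whose coefficients are the sums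
occurring in the Veronese sections when `w` is the conjugate of `z`. -/
noncomputable def veroneseGen {R : Type*} [CommRing R] (n r : ℕ) (z w : R) : R[X] :=
  (X + C z) ^ r * (1 - C w * X) ^ (n - r)

open Polynomial in
theorem coeff_one_sub_C_mul_X_pow {R : Type*} [CommRing R] (w : R) (m k : ℕ) :
    ((1 - C w * X) ^ m : R[X]).coeff k = (-1) ^ k * w ^ k * (m.choose k : R) := by
  have h : ((1 - C w * X) ^ m : R[X]) = ((1 + X) ^ m : R[X]).comp (C (-w) * X) := by
    simp [sub_eq_add_neg]
  rw [h, comp_C_mul_X_coeff, coeff_one_add_X_pow, neg_pow w k]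
  ring

theorem coeff_veroneseGen {R : Type*} [CommRing R] (n r j : ℕ) (z w : R) :
    (veroneseGen n r z w).coeff j = ∑ k ∈ range (j + 1),
      (-1 : R) ^ k * (r.choose (j - k) : R) * ((n - r).choose k : R) *
        z ^ (r - (j - k)) * w ^ k := by
  rw [veroneseGen, mul_comm, Polynomial.coeff_mul, Finset.Nat.sum_antidiagonal_eq_sum_range_succ_mk]
  refine sum_congr rfl fun k _ => ?_
  simp only [coeff_one_sub_C_mul_X_pow, Polynomial.coeff_X_add_C_pow]
  ring

theorem conj_coeff_veroneseGen (n r j : ℕ) (z : ℂ) :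
    starRingEnd ℂ ((veroneseGen n r z (starRingEnd ℂ z)).coeff j) =
      (veroneseGen n r (starRingEnd ℂ z) z).coeff j := by
  simp [coeff_veroneseGen]

open Polynomial in
/-- The two-variable generating identity: the binomially weighted sum of products of generating
polynomials collapses to `((1 + z w)(1 + t s))^n`. -/
theorem sum_choose_mul_veroneseGen {R : Type*} [CommRing R] (n : ℕ) (z w : R) :
    ∑ r ∈ range (n + 1), C (C (n.choose r : R)) *
        (C (veroneseGen n r z w) * (veroneseGen n r w z).map C) =
      C (C ((1 + z * w) ^ n)) * (1 + C X * X : R[X][X]) ^ n := by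
  have h : (C (C (1 + z * w)) * (1 + C X * X) : R[X][X]) =
      (C (X + C z) * (X + C (C w))) + (C (1 - C w * X) * (1 - C (C z) * X)) := by
    simp only [map_add, map_sub, map_mul, map_one]
    ring
  rw [C_pow, C_pow, ← mul_pow, h, add_pow]
  refine sum_congr rfl fun r _ => ?_
  simp only [veroneseGen, Polynomial.map_mul, Polynomial.map_pow, Polynomial.map_add,
    Polynomial.map_sub, Polynomial.map_one, map_X, map_C, map_mul, map_pow, mul_pow, map_natCast]
  ring

open Polynomial in
theorem sum_choose_mul_coeff_veroneseGen {R : Type*} [CommRing R] (n j : ℕ) (z w : R) :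
    ∑ r ∈ range (n + 1), (n.choose r : R) *
        ((veroneseGen n r z w).coeff j * (veroneseGen n r w z).coeff j) =
      (n.choose j : R) * (1 + z * w) ^ n := by
  have h := congrArg (fun p : R[X][X] => (p.coeff j).coeff j) (sum_choose_mul_veroneseGen n z w)
  have hc : ((1 + C X * X : R[X][X]) ^ n).coeff j = X ^ j * C (n.choose j : R) := by
    have h1 : ((1 + C X * X : R[X][X]) ^ n) = ((1 + X) ^ n : R[X][X]).comp (C X * X) := by simp
    rw [h1, comp_C_mul_X_coeff, coeff_one_add_X_pow, map_natCast, mul_comm]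
  simp only [finsetSum_coeff, coeff_C_mul, coeff_map, coeff_mul_C, hc, coeff_X_pow_self,
    one_mul] at h
  rw [h, mul_comm]

theorem sum_choose_mul_normSq_coeff_veroneseGen (n j : ℕ) (z : ℂ) :
    ∑ r ∈ range (n + 1), (n.choose r : ℝ) *
        Complex.normSq ((veroneseGen n r z (starRingEnd ℂ z)).coeff j) =
      (n.choose j : ℝ) * (1 + Complex.normSq z) ^ n := by
  have h := sum_choose_mul_coeff_veroneseGen n j z (starRingEnd ℂ z)
  simp only [← conj_coeff_veroneseGen, Complex.mul_conj] at h
  exact_mod_cast h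

theorem normSq_veroneseSection (n j : ℕ) (z : ℂ) (r : Fin (n + 1)) :
    Complex.normSq (veroneseSection n j z r) =
      ((j.factorial : ℝ) / (1 + Complex.normSq z) ^ j) ^ 2 * ((n.choose r : ℝ) *
        Complex.normSq ((veroneseGen n r z (starRingEnd ℂ z)).coeff j)) := by
  have h : ((j.factorial : ℂ) / (1 + (Complex.normSq z : ℂ)) ^ j) =
      (((j.factorial : ℝ) / (1 + Complex.normSq z) ^ j : ℝ) : ℂ) := by
    push_cast
    rfl
  rw [veroneseSection, ← coeff_veroneseGen, h, Complex.normSq_mul, Complex.normSq_mul,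
    Complex.normSq_ofReal, Complex.normSq_ofReal, Real.mul_self_sqrt (Nat.cast_nonneg _)]
  ring

/-- For `n ≥ 1`, `0 ≤ j ≤ n` and `z ∈ ℂ`,
`‖V̂ⱼⁿ(z)‖² = (n!·j!/(n−j)!)·(1+|z|²)^{n−2j}`. -/
theorem veronese_section_norm_sq (n j : ℕ) (hn : 1 ≤ n) (hj : j ≤ n) (z : ℂ) :
    ∑ r, Complex.normSq (veroneseSection n j z r) =
      ((n.factorial * j.factorial : ℝ) / (n - j).factorial) *
        (1 + Complex.normSq z) ^ ((n : ℤ) - 2 * j) := by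
  have hx : 0 < 1 + Complex.normSq z := by linarith [Complex.normSq_nonneg z]
  simp only [normSq_veroneseSection]
  rw [← mul_sum, Fin.sum_univ_eq_sum_range (fun r => (n.choose r : ℝ) *
      Complex.normSq ((veroneseGen n r z (starRingEnd ℂ z)).coeff j)),
    sum_choose_mul_normSq_coeff_veroneseGen, Nat.cast_choose ℝ hj, zpow_sub₀ hx.ne',
    mul_comm (2 : ℤ), zpow_mul, zpow_natCast, zpow_natCast, zpow_ofNat]
  field_simp
end

section
/- For every integer n ≥ 1, every integer j with 0 ≤ j ≤ n, and every z ∈ ℂ, the Veronese sections satisfy the recursion V̂_{j+1}ⁿ(z) = ∂_z V̂ⱼⁿ(z) − ((n−2j)·conj(z)/(1+|z|²))·V̂ⱼⁿ(z), where by convention V̂_{n+1}ⁿ := 0 (so for j = n the right-hand side vanishes identically). -/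
open Complex Finset

/-- The Wirtinger derivative `∂_z F = (1/2)(∂F/∂x − i·∂F/∂y)` of `F : ℂ → ℂ`, where `z = x + iy`. -/
noncomputable def wirtingerZ (F : ℂ → ℂ) (z : ℂ) : ℂ :=
  (1 / 2 : ℂ) * (fderiv ℝ F z 1 - Complex.I * fderiv ℝ F z Complex.I)

open Polynomial in
/-- The sums in the Veronese sections are the coefficients of `(X + z)^r (1 - w X)^m`. -/
theorem coeff_X_add_C_pow_mul_one_sub_pow (r m j : ℕ) (z w : ℂ) :
    ((X + C z) ^ r * (1 - C w * X) ^ m : ℂ[X]).coeff j =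
      ∑ k ∈ Finset.range (j + 1),
        (-1 : ℂ) ^ k * (r.choose (j - k) : ℂ) * (m.choose k : ℂ) * z ^ (r - (j - k)) * w ^ k := by
  have hcomp : ((1 - C w * X) ^ m : ℂ[X]) = ((1 + X) ^ m : ℂ[X]).comp (C (-w) * X) := by
    simp [sub_eq_add_neg]
  rw [mul_comm, coeff_mul, Finset.Nat.sum_antidiagonal_eq_sum_range_succ_mk]
  refine Finset.sum_congr rfl fun k _ => ?_
  rw [hcomp, comp_C_mul_X_coeff, coeff_one_add_X_pow, coeff_X_add_C_pow, neg_pow w]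
  ring

open Polynomial in
/-- The differential equation of the generating polynomial, read off coefficientwise. -/
theorem succ_mul_coeff_generating (r m j : ℕ) (z w : ℂ) :
    ((j : ℂ) + 1) * ((X + C z) ^ r * (1 - C w * X) ^ m : ℂ[X]).coeff (j + 1) =
      (1 + z * w) * (r * ((X + C z) ^ (r - 1) * (1 - C w * X) ^ m : ℂ[X]).coeff j) -
        ((r : ℂ) + m - j) * w * ((X + C z) ^ r * (1 - C w * X) ^ m : ℂ[X]).coeff j := by
  set G : ℂ[X] := (X + C z) ^ r * (1 - C w * X) ^ m with hG
  have hode : derivative G = C ((1 + z * w) * r) * ((X + C z) ^ (r - 1) * (1 - C w * X) ^ m) -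
      C (((r : ℂ) + m) * w) * G + C w * (derivative G * X) := by
    rw [hG]
    rcases r with _ | r <;> rcases m with _ | m <;>
      simp [derivative_mul, derivative_pow] <;> ring
  have hcoeff := congrArg (fun p : ℂ[X] => p.coeff j) hode
  have hX : (derivative G * X).coeff j = j * G.coeff j := by
    rcases j with _ | j
    · simp
    · rw [coeff_mul_X, coeff_derivative]
      push_cast
      ring
  simp only [coeff_add, coeff_sub, coeff_C_mul, hX, coeff_derivative] at hcoeff
  linear_combination hcoeff

open Polynomial in
theorem hasDerivAt_coeff_generating (r m j : ℕ) (z w : ℂ) :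
    HasDerivAt (fun u : ℂ => ((X + C u) ^ r * (1 - C w * X) ^ m : ℂ[X]).coeff j)
      (r * ((X + C z) ^ (r - 1) * (1 - C w * X) ^ m : ℂ[X]).coeff j) z := by
  simp only [coeff_X_add_C_pow_mul_one_sub_pow, Finset.mul_sum]
  refine HasDerivAt.fun_sum fun k _ => ?_
  refine (((hasDerivAt_pow (r - (j - k)) z).const_mul
    ((-1 : ℂ) ^ k * (r.choose (j - k) : ℂ) * (m.choose k : ℂ))).mul_const (w ^ k)).congr_deriv ?_
  generalize j - k = a
  have hchoose : (r : ℂ) * ((r - 1).choose a : ℂ) = (r.choose a : ℂ) * ((r - a : ℕ) : ℂ) := by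
    rcases r with _ | r
    · simp
    · have h := Nat.choose_mul_succ_eq r a
      rw [Nat.add_sub_cancel, mul_comm]
      exact_mod_cast h
  rw [Nat.sub_right_comm r 1 a]
  linear_combination -(-1 : ℂ) ^ k * (m.choose k : ℂ) * z ^ (r - a - 1) * w ^ k * hchoose

/-- The Wirtinger derivative of `w ↦ g (w, conj w)` with `g` holomorphic is the partial derivative
of `g` in its first variable. -/
theorem wirtingerZ_comp_conj {g : ℂ × ℂ → ℂ} {z d : ℂ}
    (hg : DifferentiableAt ℂ g (z, (starRingEnd ℂ) z))
    (hd : HasDerivAt (fun u => g (u, (starRingEnd ℂ) z)) d z) :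
    wirtingerZ (fun u => g (u, (starRingEnd ℂ) u)) z = d := by
  set L := fderiv ℂ g (z, (starRingEnd ℂ) z)
  have hL : HasFDerivAt g L (z, (starRingEnd ℂ) z) := hg.hasFDerivAt
  have hF := (hL.restrictScalars ℝ).comp z
    ((hasFDerivAt_id (𝕜 := ℝ) z).prodMk Complex.conjCLE.hasFDerivAt)
  have hpartial := HasFDerivAt.comp_hasDerivAt (f := fun u => (u, (starRingEnd ℂ) z)) z hL
    ((hasDerivAt_id z).prodMk (hasDerivAt_const z _))
  have hd' : L (1, 0) = d := hpartial.unique hd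
  have hI : ∀ a b : ℂ, L (a, b) = a * L (1, 0) + b * L (0, 1) := fun a b => by
    rw [← smul_eq_mul, ← smul_eq_mul, ← map_smul, ← map_smul, ← map_add]
    simp
  have hfd : fderiv ℝ (fun u => g (u, (starRingEnd ℂ) u)) z = _ := hF.fderiv
  rw [wirtingerZ, hfd]
  simp only [ContinuousLinearMap.comp_apply, ContinuousLinearMap.prod_apply,
    ContinuousLinearMap.coe_restrictScalars', ContinuousLinearMap.id_apply,
    ContinuousLinearEquiv.coe_coe, Complex.conjCLE_apply, map_one, Complex.conj_I]
  rw [hI 1 1, hI Complex.I, hd']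
  linear_combination (-(1 / 2) * d + 1 / 2 * L (0, 1)) * Complex.I_sq

theorem one_add_normSq_ne_zero (z : ℂ) : (1 + (Complex.normSq z : ℂ)) ≠ 0 := by
  have := Complex.normSq_nonneg z
  exact_mod_cast (by positivity : 1 + Complex.normSq z ≠ 0)

open Polynomial in
theorem veroneseSection_eq_coeff (n j : ℕ) (z : ℂ) (r : Fin (n + 1)) :
    veroneseSection n j z r =
      (j.factorial : ℂ) / (1 + z * (starRingEnd ℂ) z) ^ j * (Real.sqrt (n.choose (r : ℕ)) : ℂ) *
        ((X + C z) ^ (r : ℕ) * (1 - C ((starRingEnd ℂ) z) * X) ^ (n - (r : ℕ)) : ℂ[X]).coeff j := by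
  rw [veroneseSection, coeff_X_add_C_pow_mul_one_sub_pow, Complex.mul_conj]

open Polynomial in
theorem wirtingerZ_veroneseSection (n j : ℕ) (z : ℂ) (r : Fin (n + 1)) :
    wirtingerZ (fun w => veroneseSection n j w r) z =
      (j.factorial : ℂ) / (1 + (Complex.normSq z : ℂ)) ^ j * (Real.sqrt (n.choose (r : ℕ)) : ℂ) *
        ((r : ℕ) * ((X + C z) ^ ((r : ℕ) - 1) *
          (1 - C ((starRingEnd ℂ) z) * X) ^ (n - (r : ℕ)) : ℂ[X]).coeff j) -
      j * (starRingEnd ℂ) z / (1 + (Complex.normSq z : ℂ)) * veroneseSection n j z r := by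
  have hne := one_add_normSq_ne_zero z
  rw [← Complex.mul_conj] at hne
  simp only [veroneseSection_eq_coeff, ← Complex.mul_conj]
  refine wirtingerZ_comp_conj (g := fun p : ℂ × ℂ =>
    (j.factorial : ℂ) / (1 + p.1 * p.2) ^ j * (Real.sqrt (n.choose (r : ℕ)) : ℂ) *
      ((X + C p.1) ^ (r : ℕ) * (1 - C p.2 * X) ^ (n - (r : ℕ)) : ℂ[X]).coeff j) ?_ ?_
  · simp only [coeff_X_add_C_pow_mul_one_sub_pow]
    have hpow := pow_ne_zero j hne
    fun_prop (disch := assumption)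
  · have hden := (((hasDerivAt_id z).mul_const ((starRingEnd ℂ) z)).const_add 1).fun_pow j
    have hfac := ((hasDerivAt_const z (j.factorial : ℂ)).fun_div hden
      (pow_ne_zero j hne)).mul_const (Real.sqrt (n.choose (r : ℕ)) : ℂ)
    refine (hfac.fun_mul
      (hasDerivAt_coeff_generating r (n - r) j z ((starRingEnd ℂ) z))).congr_deriv ?_
    simp only [id]
    rcases j with _ | j
    · simp
    · simp only [Nat.add_sub_cancel]
      field_simp
      ring

/-- For `n ≥ 1`, `0 ≤ j ≤ n` and `z ∈ ℂ`, the Veronese sections satisfy the recursion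
`V̂_{j+1}ⁿ(z) = ∂_z V̂ⱼⁿ(z) − ((n−2j)·conj(z)/(1+|z|²))·V̂ⱼⁿ(z)`,
with the convention `V̂_{n+1}ⁿ := 0` (so for `j = n` the right-hand side vanishes). -/
theorem veronese_section_recursion (n j : ℕ) (hn : 1 ≤ n) (hj : j ≤ n) (z : ℂ) :
    (if j = n then (0 : Fin (n + 1) → ℂ) else veroneseSection n (j + 1) z) =
      fun r =>
        wirtingerZ (fun w => veroneseSection n j w r) z -
          (((n : ℂ) - 2 * j) * (starRingEnd ℂ) z / (1 + (Complex.normSq z : ℂ))) *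
            veroneseSection n j z r := by
  have hne := one_add_normSq_ne_zero z
  have hlhs : (if j = n then (0 : Fin (n + 1) → ℂ) else veroneseSection n (j + 1) z) =
      veroneseSection n (j + 1) z := by
    split_ifs with h
    · subst h
      funext r
      symm
      rw [veroneseSection, Finset.sum_eq_zero, mul_zero, Pi.zero_apply]
      intro k _
      rcases lt_or_ge (j - (r : ℕ)) k with hk | hk
      · simp [Nat.choose_eq_zero_of_lt hk]
      · have hr : (r : ℕ) < j + 1 - k := by have := r.isLt; omega
        simp [Nat.choose_eq_zero_of_lt hr]
    · rfl
  rw [hlhs]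
  funext r
  have hr : (((n - (r : ℕ) : ℕ)) : ℂ) = n - (r : ℕ) := Nat.cast_sub (Nat.le_of_lt_succ r.isLt)
  have key := succ_mul_coeff_generating r (n - r) j z ((starRingEnd ℂ) z)
  rw [hr] at key
  rw [wirtingerZ_veroneseSection, veroneseSection_eq_coeff, veroneseSection_eq_coeff,
    Nat.factorial_succ]
  rw [← Complex.mul_conj] at hne ⊢
  push_cast
  field_simp
  linear_combination (j.factorial * (Real.sqrt (n.choose (r : ℕ)) : ℂ) *
    (1 + z * (starRingEnd ℂ) z) ^ (j + 1)) * key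
end

section
/- For n = 4 and every z ∈ ℂ, the second Wirtinger derivative of the zeroth Veronese section decomposes as ∂_z² V̂₀⁴(z) = V̂₂⁴(z) + (6·conj(z)/(1+|z|²))·V̂₁⁴(z) + (12·conj(z)²/(1+|z|²)²)·V̂₀⁴(z). -/
open Complex Finset

/-- Componentwise Wirtinger derivative for vector-valued maps. -/
noncomputable def wirtingerZVec {m : ℕ} (F : ℂ → Fin m → ℂ) (z : ℂ) : Fin m → ℂ :=
  fun r => wirtingerZ (fun w => F w r) z

/-- On holomorphic functions the Wirtinger derivative is the complex derivative. -/
theorem HasDerivAt.wirtingerZ_eq {F : ℂ → ℂ} {F' z : ℂ} (h : HasDerivAt F F' z) :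
    wirtingerZ F z = F' := by
  have hF := (h.hasFDerivAt.restrictScalars ℝ).fderiv
  simp only [wirtingerZ, hF, ContinuousLinearMap.coe_restrictScalars',
    ContinuousLinearMap.toSpanSingleton_apply, smul_eq_mul]
  linear_combination (-F' / 2) * Complex.I_mul_I

theorem wirtingerZ_const_mul_pow (c : ℂ) (m : ℕ) (z : ℂ) :
    wirtingerZ (fun w => c * w ^ m) z = c * m * z ^ (m - 1) := by
  rw [((hasDerivAt_pow m z).const_mul c).wirtingerZ_eq, mul_assoc]

theorem veroneseSection_zero (n : ℕ) (z : ℂ) (r : Fin (n + 1)) :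
    veroneseSection n 0 z r = (Real.sqrt (n.choose (r : ℕ)) : ℂ) * z ^ (r : ℕ) := by
  simp [veroneseSection]

/-- For `n = 4` and every `z ∈ ℂ`, the second Wirtinger derivative of the zeroth Veronese
section decomposes as
`∂_z² V̂₀⁴(z) = V̂₂⁴(z) + (6·conj(z)/(1+|z|²))·V̂₁⁴(z) + (12·conj(z)²/(1+|z|²)²)·V̂₀⁴(z)`. -/
theorem veronese_second_derivative_decomposition (z : ℂ) :
    wirtingerZVec (fun w => wirtingerZVec (veroneseSection 4 0) w) z =
      fun r =>
        veroneseSection 4 2 z r +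
          6 * (starRingEnd ℂ) z / (1 + (Complex.normSq z : ℂ)) * veroneseSection 4 1 z r +
          12 * ((starRingEnd ℂ) z) ^ 2 / (1 + (Complex.normSq z : ℂ)) ^ 2 *
            veroneseSection 4 0 z r := by
  funext r
  have hz : (1 + z * (starRingEnd ℂ) z) ≠ 0 := by
    rw [Complex.mul_conj]
    exact_mod_cast (add_pos_of_pos_of_nonneg one_pos (Complex.normSq_nonneg z)).ne'
  simp only [wirtingerZVec, veroneseSection_zero, wirtingerZ_const_mul_pow]
  simp only [veroneseSection, ← Complex.mul_conj, Finset.sum_range_succ, Finset.sum_range_zero]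
  generalize (starRingEnd ℂ) z = y at hz ⊢
  generalize (Real.sqrt (Nat.choose 4 (r : ℕ)) : ℂ) = c
  fin_cases r <;> simp [Nat.choose, Nat.factorial] <;> field_simp <;> ring
end

section
/- Let P be a polynomial in one complex variable and let Q be a polynomial in two complex variables. If for every z ∈ ℂ one has P(z)·conj(P(z)) = (1 + z·conj(z))·Q(z, conj(z)), then P = 0. In other words, for a nonzero one-variable complex polynomial P, the function |P(z)|² is never divisible by (1 + z·conj(z)) in the ring of polynomial functions of z and conj(z). -/
open Complex Polynomial

/-- A complex polynomial in two variables that vanishes at `(z, conj z)` for every `z` is zero. -/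
theorem MvPolynomial.eq_zero_of_eval_conj_eq_zero (F : MvPolynomial (Fin 2) ℂ)
    (hF : ∀ z : ℂ, MvPolynomial.eval ![z, (starRingEnd ℂ) z] F = 0) : F = 0 := by
  let G : MvPolynomial (Fin 2) ℂ := MvPolynomial.bind₁
    ![.X 0 + .C I * .X 1, .X 0 - .C I * .X 1] F
  have eval_G (x : Fin 2 → ℂ) :
      MvPolynomial.eval x G = MvPolynomial.eval ![x 0 + I * x 1, x 0 - I * x 1] F := by
    change MvPolynomial.eval₂Hom _ _ (MvPolynomial.bind₁ _ F) = _
    rw [MvPolynomial.eval₂Hom_bind₁]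
    change MvPolynomial.eval _ F = _
    congr 2
    funext i
    fin_cases i <;> simp
  have hinf : (Set.range ((↑) : ℝ → ℂ)).Infinite :=
    Set.infinite_range_of_injective ofReal_injective
  have hG : G = 0 := by
    refine MvPolynomial.funext_set (fun _ ↦ Set.range ((↑) : ℝ → ℂ)) (fun _ ↦ hinf) fun x hx ↦ ?_
    obtain ⟨a, ha⟩ := hx 0 trivial
    obtain ⟨b, hb⟩ := hx 1 trivial
    rw [eval_G, map_zero, ← hF (a + I * b), ← ha, ← hb]
    congr 3
    simp [sub_eq_add_neg]
  refine MvPolynomial.funext fun x ↦ ?_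
  have hx := eval_G ![(x 0 + x 1) / 2, (x 0 - x 1) / (2 * I)]
  rw [hG, map_zero] at hx
  rw [map_zero, hx]
  congr 2
  funext i
  fin_cases i <;> simp <;> field_simp <;> ring

theorem MvPolynomial.eval_aeval_X {σ R : Type*} [CommSemiring R] (x : σ → R) (i : σ)
    (p : Polynomial R) :
    MvPolynomial.eval x (Polynomial.aeval (MvPolynomial.X i) p) = p.eval (x i) := by
  rw [← MvPolynomial.coe_aeval_eq_eval, RingHom.coe_coe, ← Polynomial.aeval_algHom_apply]
  simp

/-- Let `P ∈ ℂ[X]` and `Q ∈ ℂ[X,Y]`. If for every `z ∈ ℂ`,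
`P(z)·conj(P(z)) = (1 + z·conj(z))·Q(z, conj(z))`, then `P = 0`; i.e. for a nonzero
one-variable complex polynomial `P`, the function `|P(z)|²` is never divisible by
`1 + z·conj(z)` in the ring of polynomial functions of `z` and `conj(z)`. -/
theorem normSq_poly_not_divisible (P : Polynomial ℂ) (Q : MvPolynomial (Fin 2) ℂ)
    (h : ∀ z : ℂ,
      P.eval z * (starRingEnd ℂ) (P.eval z) =
        (1 + z * (starRingEnd ℂ) z) * MvPolynomial.eval ![z, (starRingEnd ℂ) z] Q) :
    P = 0 := by
  have hF : Polynomial.aeval (MvPolynomial.X 0) P *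
      Polynomial.aeval (MvPolynomial.X 1) (P.map (starRingEnd ℂ)) -
        (1 + MvPolynomial.X 0 * MvPolynomial.X 1) * Q = 0 := by
    refine MvPolynomial.eq_zero_of_eval_conj_eq_zero _ fun z ↦ ?_
    have hPz := Polynomial.eval_map_apply (f := starRingEnd ℂ) (p := P) z
    simp [MvPolynomial.eval_aeval_X, hPz, h z]
  have hroot (z : ℂ) (hz : z ≠ 0) : P.eval z = 0 ∨ P.eval (-((starRingEnd ℂ) z)⁻¹) = 0 := by
    have hzF := congrArg (MvPolynomial.eval ![z, -z⁻¹]) hF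
    have hconj : -z⁻¹ = (starRingEnd ℂ) (-((starRingEnd ℂ) z)⁻¹) := by simp
    have hPz : (P.map (starRingEnd ℂ)).eval (-z⁻¹) =
        (starRingEnd ℂ) (P.eval (-((starRingEnd ℂ) z)⁻¹)) := by
      rw [hconj, Polynomial.eval_map_apply]
    simpa [MvPolynomial.eval_aeval_X, hPz, hz] using hzF
  by_contra hP
  obtain ⟨z, hz⟩ := Infinite.exists_notMem_finset
    (insert 0 (P.roots.toFinset ∪ P.roots.toFinset.image fun w ↦ -((starRingEnd ℂ) w)⁻¹))
  simp only [Finset.mem_insert, Finset.mem_union, Finset.mem_image, Multiset.mem_toFinset,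
    Polynomial.mem_roots hP, Polynomial.IsRoot.def, not_or] at hz
  rcases hroot z hz.1 with h0 | h0
  · exact hz.2.1 h0
  · exact hz.2.2 ⟨_, h0, by simp⟩
end

section
/- Let p be a nonzero polynomial in two complex variables X, Y such that every zero of p in ℂ² lies on the hypersurface {(x,y) ∈ ℂ² : 1 + x·y = 0}, i.e., for all (x,y) ∈ ℂ², p(x,y) = 0 implies 1 + x·y = 0. Then there exist a nonzero constant c ∈ ℂ and a natural number m such that p = c·(1 + X·Y)^m. -/
open MvPolynomial

theorem irreducible_one_add_X_mul_X {σ R : Type*} [CommRing R] [IsDomain R] {i j : σ}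
    (hij : i ≠ j) : Irreducible (1 + X i * X j : MvPolynomial σ R) := by
  have h := MvPolynomial.irreducible_mul_X_add (X i : MvPolynomial σ R) 1 j (X_ne_zero i)
    (by simpa [vars_X] using hij.symm) (by simp) isRelPrime_one_right
  rwa [add_comm] at h

/-- Over an algebraically closed field, a polynomial whose zeros all lie on the hypersurface cut
out by `q` divides a power of `q`. -/
theorem exists_dvd_pow_of_forall_eval_eq_zero {σ K : Type*} [Finite σ] [Field K] [IsAlgClosed K]
    {p q : MvPolynomial σ K} (h : ∀ x, eval x p = 0 → eval x q = 0) : ∃ n : ℕ, p ∣ q ^ n := by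
  have hq : q ∈ vanishingIdeal K (zeroLocus K (Ideal.span {p})) := by
    simpa [zeroLocus_span, aeval_eq_eval] using h
  rw [vanishingIdeal_zeroLocus_eq_radical] at hq
  exact hq.imp fun _ hn => Ideal.mem_span_singleton.mp hn

/-- Let `p ∈ ℂ[X,Y]` be a nonzero polynomial all of whose zeros in `ℂ²` lie on the
hypersurface `{1 + x·y = 0}`. Then `p = c·(1 + X·Y)^m` for some nonzero constant `c`
and natural number `m`. -/
theorem zero_set_in_hypersurface (p : MvPolynomial (Fin 2) ℂ) (hp : p ≠ 0)
    (h : ∀ x y : ℂ, MvPolynomial.eval ![x, y] p = 0 → 1 + x * y = 0) :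
    ∃ c : ℂ, c ≠ 0 ∧ ∃ m : ℕ,
      p = MvPolynomial.C c * (1 + MvPolynomial.X 0 * MvPolynomial.X 1) ^ m := by
  obtain ⟨n, hn⟩ := exists_dvd_pow_of_forall_eval_eq_zero
    (p := p) (q := 1 + X 0 * X 1) fun x hx => by
      have hxy : ![x 0, x 1] = x := by ext i; fin_cases i <;> rfl
      simpa using h (x 0) (x 1) (hxy ▸ hx)
  have hprime : Prime (1 + X 0 * X 1 : MvPolynomial (Fin 2) ℂ) :=
    (irreducible_one_add_X_mul_X zero_ne_one).prime
  obtain ⟨m, -, hm⟩ := (dvd_prime_pow hprime n).mp hn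
  obtain ⟨u, hu⟩ := hm.symm
  obtain ⟨c, hc, huc⟩ := isUnit_iff_eq_C_of_isReduced.mp u.isUnit
  exact ⟨c, hc.ne_zero, m, by rw [← hu, huc, mul_comm]⟩
end
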